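/- Let n ≥ 2, N = 2n, and consider the N-qubit Hilbert space (ℂ²)^{⊗N} with sites indexed cyclically (periodic boundary conditions). Let S_i^α denote the operator acting as (1/2)σ^α on site i and as the identity elsewhere, let S_i·S_j = Σ_{α∈{x,y,z}} S_i^α S_j^α, and let H = Σ_{i=1}^N (S_i·S_{i+1} + (1/2) S_i·S_{i+2}) be the Majumdar–Ghosh Hamiltonian (the J₁–J₂ Heisenberg chain at J₂/J₁ = 1/2 with J₁ = 1). Then the dimerized state Ψ = ⊗_{k=1}^n |s⟩_{2k−1,2k}, where |s⟩ = (|01⟩ − |10⟩)/√2 is the two-qubit singlet, is an eigenvector of H with eigenvalue −3N/8, this eigenvalue is the smallest eigenvalue of H, and the translated dimer covering ⊗_{k=1}^n |s⟩_{2k,2k+1} is likewise an eigenvector of H with the same smallest eigenvalue. -/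

import Mathlib

open Matrix BigOperators

noncomputable section

def sigmaX : Matrix (Fin 2) (Fin 2) ℂ := !![0, 1; 1, 0]
def sigmaY : Matrix (Fin 2) (Fin 2) ℂ := !![0, -Complex.I; Complex.I, 0]
def sigmaZ : Matrix (Fin 2) (Fin 2) ℂ := !![1, 0; 0, -1]

/-- The operator on the `N`-qubit Hilbert space acting as the single-site matrix `a`
on site `i` and as the identity on all other sites. -/
def siteOp (N : ℕ) (i : Fin N) (a : Matrix (Fin 2) (Fin 2) ℂ) :
    Matrix (Fin N → Fin 2) (Fin N → Fin 2) ℂ :=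
  Matrix.of fun s t => if ∀ v, v ≠ i → s v = t v then a (s i) (t i) else 0

/-- The Heisenberg exchange `S_i·S_j = Σ_α S_i^α S_j^α` with `S^α = ½σᵅ`. -/
def SdotS (N : ℕ) (i j : Fin N) : Matrix (Fin N → Fin 2) (Fin N → Fin 2) ℂ :=
  (1/4 : ℂ) • (siteOp N i sigmaX * siteOp N j sigmaX
    + siteOp N i sigmaY * siteOp N j sigmaY
    + siteOp N i sigmaZ * siteOp N j sigmaZ)

/-- The amplitudes of the two-qubit singlet `|s⟩ = (|01⟩ − |10⟩)/√2`. -/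
def sAmp : Fin 2 → Fin 2 → ℂ := fun a b =>
  if a = 0 ∧ b = 1 then (Real.sqrt 2 : ℂ)⁻¹
  else if a = 1 ∧ b = 0 then -(Real.sqrt 2 : ℂ)⁻¹ else 0

open Function in
lemma siteOp_mulVec {N : ℕ} (i : Fin N) (a : Matrix (Fin 2) (Fin 2) ℂ)
    (v : (Fin N → Fin 2) → ℂ) (s : Fin N → Fin 2) :
    (siteOp N i a).mulVec v s = ∑ b, a (s i) b * v (update s i b) := by
  symm
  simp only [Matrix.mulVec, dotProduct]
  refine Finset.sum_of_injOn (fun b => update s i b) ?_ ?_ ?_ ?_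
  · intro b _ c _ h
    exact update_injective s i h
  · intro b _
    simp
  · intro t _ ht
    have : ¬ ∀ w, w ≠ i → s w = t w := by
      intro h
      apply ht
      refine ⟨t i, by simp, ?_⟩
      ext w
      by_cases hw : w = i
      · subst hw; simp
      · simp [hw, h w hw]
    simp [siteOp, this]
  · intro b _
    have : ∀ w, w ≠ i → s w = update s i b w := fun w hw => by simp [hw]
    simp only [siteOp, Matrix.of_apply, if_pos this, update_self]

open Function in
lemma SdotS_mulVec {N : ℕ} {i j : Fin N} (hij : i ≠ j)
    (v : (Fin N → Fin 2) → ℂ) (s : Fin N → Fin 2) :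
    (SdotS N i j).mulVec v s = (1/2) * v (s ∘ Equiv.swap i j) - (1/4) * v s := by
  have h1 : v (s ∘ Equiv.swap i j) = v (update (update s i (s j)) j (s i)) := by
    rw [Equiv.comp_swap_eq_update, update_comm hij]
  have h2 : v s = v (update (update s i (s i)) j (s j)) := by simp
  rw [h1, h2]
  simp only [SdotS, Matrix.smul_mulVec, Matrix.add_mulVec, Pi.smul_apply, Pi.add_apply,
    ← Matrix.mulVec_mulVec, siteOp_mulVec, update_of_ne hij.symm]
  generalize s i = p
  generalize s j = q
  generalize hw : (fun b c => v (update (update s i b) j c)) = w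
  have hw' : ∀ b c, v (update (update s i b) j c) = w b c := fun b c => by rw [← hw]
  simp only [hw', Fin.sum_univ_two, smul_eq_mul]
  fin_cases p <;> fin_cases q <;> simp [sigmaX, sigmaY, sigmaZ, ← mul_assoc] <;> ring

/-- The sum of the three exchange operators on the sites `a`, `b`, `c`. -/
def swapSum {N : ℕ} (a b c : Fin N) (v : (Fin N → Fin 2) → ℂ) (s : Fin N → Fin 2) : ℂ :=
  v (s ∘ Equiv.swap a b) + v (s ∘ Equiv.swap b c) + v (s ∘ Equiv.swap a c)

lemma swapSum_rotate {N : ℕ} (a b c : Fin N) (v : (Fin N → Fin 2) → ℂ) :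
    swapSum b c a v = swapSum a b c v := by
  ext s
  simp only [swapSum, Equiv.swap_comm c a, Equiv.swap_comm b a]
  ring

lemma comp_swap_of_eq {N : ℕ} {a b : Fin N} {s : Fin N → Fin 2} (h : s a = s b) :
    s ∘ Equiv.swap a b = s := by
  rw [Equiv.comp_swap_eq_update, h, Function.update_eq_self, ← h, Function.update_eq_self]

lemma comp_swap_comp_swap {N : ℕ} {a b c : Fin N} (hab : a ≠ b) (hac : a ≠ c) (hbc : b ≠ c)
    (s : Fin N → Fin 2) :
    (s ∘ Equiv.swap a c) ∘ Equiv.swap a b = (s ∘ Equiv.swap a b) ∘ Equiv.swap b c := by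
  ext x
  simp only [Function.comp_apply, Equiv.swap_apply_def]
  grind

lemma comp_swap_self {N : ℕ} (a b : Fin N) (s : Fin N → Fin 2) :
    (s ∘ Equiv.swap a b) ∘ Equiv.swap a b = s := by
  ext x; simp

/-- The antisymmetrizer of three qubits vanishes. -/
lemma swapSum_eq_cyclicSum {N : ℕ} {a b c : Fin N} (hab : a ≠ b) (hac : a ≠ c) (hbc : b ≠ c)
    (v : (Fin N → Fin 2) → ℂ) (s : Fin N → Fin 2) :
    swapSum a b c v s = v s + v ((s ∘ Equiv.swap a b) ∘ Equiv.swap b c)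
      + v ((s ∘ Equiv.swap a b) ∘ Equiv.swap a c) := by
  have e1 := comp_swap_comp_swap hab hac hbc s
  have e2 : (s ∘ Equiv.swap a b) ∘ Equiv.swap a c = (s ∘ Equiv.swap b c) ∘ Equiv.swap a b := by
    ext x
    simp only [Function.comp_apply, Equiv.swap_apply_def]
    grind
  have e3 : (s ∘ Equiv.swap b c) ∘ Equiv.swap a c = (s ∘ Equiv.swap a b) ∘ Equiv.swap b c := by
    ext x
    simp only [Function.comp_apply, Equiv.swap_apply_def]
    grind
  have e4 : (s ∘ Equiv.swap a c) ∘ Equiv.swap b c = (s ∘ Equiv.swap a b) ∘ Equiv.swap a c := by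
    ext x
    simp only [Function.comp_apply, Equiv.swap_apply_def]
    grind
  have : s a = s b ∨ s b = s c ∨ s a = s c := by omega
  rcases this with h | h | h
  · simp only [swapSum, comp_swap_of_eq h]
  · rw [e2, ← e3]
    simp only [swapSum, comp_swap_of_eq h]
    ring
  · rw [← e1, ← e4]
    simp only [swapSum, comp_swap_of_eq h]
    ring

lemma swapSum_comp_swap {N : ℕ} {a b c : Fin N} (hab : a ≠ b) (hac : a ≠ c) (hbc : b ≠ c)
    (v : (Fin N → Fin 2) → ℂ) (s : Fin N → Fin 2) :
    swapSum a b c v (s ∘ Equiv.swap a b) = swapSum a b c v s := by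
  rw [swapSum_eq_cyclicSum hab hac hbc v s]
  simp only [swapSum, comp_swap_self]

lemma swapSum_eq_zero {N : ℕ} {a b c : Fin N} (hab : a ≠ b) (hac : a ≠ c) (hbc : b ≠ c)
    {v : (Fin N → Fin 2) → ℂ} (hv : ∀ s, v (s ∘ Equiv.swap a b) = -v s) (s : Fin N → Fin 2) :
    swapSum a b c v s = 0 := by
  have e : (s ∘ Equiv.swap a b) ∘ Equiv.swap a c = (s ∘ Equiv.swap b c) ∘ Equiv.swap a b := by
    ext x
    simp only [Function.comp_apply, Equiv.swap_apply_def]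
    grind
  have h := swapSum_eq_cyclicSum hab hac hbc v s
  rw [← comp_swap_comp_swap hab hac hbc, e, hv, hv] at h
  simp only [swapSum, hv] at h ⊢
  linear_combination h / 2

lemma sum_star_comp_swap_mul {N : ℕ} (a b : Fin N) (v w : (Fin N → Fin 2) → ℂ)
    (hw : ∀ s, w (s ∘ Equiv.swap a b) = w s) :
    ∑ s, star (v (s ∘ Equiv.swap a b)) * w s = ∑ s, star (v s) * w s := by
  refine Fintype.sum_equiv ((Equiv.swap a b).arrowCongr (Equiv.refl _)) _ _ fun s => ?_
  have : (Equiv.swap a b).arrowCongr (Equiv.refl _) s = s ∘ Equiv.swap a b := by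
    ext x; simp
  rw [this, hw]

lemma star_dotProduct_swapSum_nonneg {N : ℕ} {a b c : Fin N}
    (hab : a ≠ b) (hac : a ≠ c) (hbc : b ≠ c) (v : (Fin N → Fin 2) → ℂ) :
    0 ≤ (∑ s, star (v s) * swapSum a b c v s).re := by
  have h1 := sum_star_comp_swap_mul a b v _ (swapSum_comp_swap hab hac hbc v)
  have h2 := sum_star_comp_swap_mul b c v _ (swapSum_comp_swap hbc hab.symm hac.symm v)
  have h3 := sum_star_comp_swap_mul c a v _ (swapSum_comp_swap hac.symm hbc.symm hab v)
  rw [swapSum_rotate] at h2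
  rw [← swapSum_rotate, Equiv.swap_comm c a] at h3
  have h : ∑ s, star (swapSum a b c v s) * swapSum a b c v s
      = 3 * ∑ s, star (v s) * swapSum a b c v s := by
    calc _ = ∑ s, star (v (s ∘ Equiv.swap a b)) * swapSum a b c v s
          + ∑ s, star (v (s ∘ Equiv.swap b c)) * swapSum a b c v s
          + ∑ s, star (v (s ∘ Equiv.swap a c)) * swapSum a b c v s := by
          rw [← Finset.sum_add_distrib, ← Finset.sum_add_distrib]
          refine Finset.sum_congr rfl fun s _ => ?_
          rw [← add_mul, ← add_mul, ← star_add, ← star_add, swapSum]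
      _ = _ := by rw [h1, h2, h3]; ring
  have hre := congrArg Complex.re h
  have hnn : 0 ≤ (∑ s, star (swapSum a b c v s) * swapSum a b c v s).re := by
    rw [Complex.re_sum]
    refine Finset.sum_nonneg fun s _ => ?_
    simp only [Complex.star_def, ← Complex.normSq_eq_conj_mul_self, Complex.ofReal_re]
    exact Complex.normSq_nonneg _
  rw [Complex.mul_re] at hre
  norm_num at hre
  norm_num at hnn ⊢
  linarith

lemma sAmp_swap (p q : Fin 2) : sAmp q p = -sAmp p q := by
  fin_cases p <;> fin_cases q <;> simp [sAmp]

/-- The product of singlets on the pairs `(f k, g k)`. -/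
def dimerState {N n : ℕ} (f g : Fin n → Fin N) (s : Fin N → Fin 2) : ℂ :=
  ∏ k, sAmp (s (f k)) (s (g k))

lemma dimerState_comp_swap {N n : ℕ} {f g : Fin n → Fin N} (hf : f.Injective) (hg : g.Injective)
    (hfg : ∀ j k, f j ≠ g k) (k : Fin n) (s : Fin N → Fin 2) :
    dimerState f g (s ∘ Equiv.swap (f k) (g k)) = -dimerState f g s := by
  simp only [dimerState]
  rw [← Finset.mul_prod_erase _ _ (Finset.mem_univ k),
    ← Finset.mul_prod_erase _ (fun j => sAmp (s (f j)) (s (g j))) (Finset.mem_univ k), ← neg_mul]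
  congr 1
  · simp [sAmp_swap (s (f k))]
  · refine Finset.prod_congr rfl fun j hj => ?_
    have hjk := Finset.ne_of_mem_erase hj
    simp only [Function.comp_apply]
    rw [Equiv.swap_apply_of_ne_of_ne (hf.ne hjk) (hfg j k),
      Equiv.swap_apply_of_ne_of_ne (hfg k j).symm (hg.ne hjk)]

lemma dimerState_ne_zero {N n : ℕ} {f g : Fin n → Fin N} (hfg : ∀ j k, f j ≠ g k) :
    dimerState f g ≠ 0 := by
  classical
  intro h
  have h0 := congrFun h fun x => if ∃ k, g k = x then 1 else 0
  simp only [dimerState, Pi.zero_apply, Finset.prod_eq_zero_iff] at h0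
  obtain ⟨k, -, hk⟩ := h0
  have hk' : ¬ ∃ j, g j = f k := fun ⟨j, hj⟩ => hfg k j hj.symm
  simp [hk', sAmp] at hk

lemma val_add_mk {N : ℕ} (i : Fin N) (m : ℕ) (hm : m < N) :
    (i + ⟨m, hm⟩).val = if i.val + m < N then i.val + m else i.val + m - N := by
  have := i.isLt
  rw [Fin.val_add]
  split_ifs with h
  · exact Nat.mod_eq_of_lt h
  · rw [Nat.mod_eq_sub_mod (by simpa using h)]
    exact Nat.mod_eq_of_lt (by simp only; omega)

lemma add_one_add_one {N : ℕ} (h1 : 1 < N) (h2 : 2 < N) (i : Fin N) :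
    i + ⟨1, h1⟩ + ⟨1, h1⟩ = i + ⟨2, h2⟩ := by
  ext
  simp only [val_add_mk]
  grind

/-- The Majumdar–Ghosh Hamiltonian on a chain of `N` qubits. -/
def majumdarGhosh (N : ℕ) (h1 : 1 < N) (h2 : 2 < N) :
    Matrix (Fin N → Fin 2) (Fin N → Fin 2) ℂ :=
  ∑ i : Fin N, (SdotS N i (i + ⟨1, h1⟩) + (1/2 : ℂ) • SdotS N i (i + ⟨2, h2⟩))

lemma consecutive_ne {N : ℕ} (h1 : 1 < N) (h2 : 2 < N) (i : Fin N) :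
    i ≠ i + ⟨1, h1⟩ ∧ i ≠ i + ⟨2, h2⟩ ∧ i + ⟨1, h1⟩ ≠ i + ⟨2, h2⟩ := by
  simp only [ne_eq, Fin.ext_iff, val_add_mk]
  grind

lemma majumdarGhosh_mulVec {N : ℕ} (h1 : 1 < N) (h2 : 2 < N) (v : (Fin N → Fin 2) → ℂ)
    (s : Fin N → Fin 2) :
    (majumdarGhosh N h1 h2).mulVec v s =
      (1/4) * ∑ i, swapSum i (i + ⟨1, h1⟩) (i + ⟨2, h2⟩) v s - 3 * N / 8 * v s := by
  have hN : NeZero N := ⟨by omega⟩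
  have hshift : ∑ i : Fin N, v (s ∘ Equiv.swap (i + ⟨1, h1⟩) (i + ⟨2, h2⟩))
      = ∑ i : Fin N, v (s ∘ Equiv.swap i (i + ⟨1, h1⟩)) := by
    refine Fintype.sum_equiv (Equiv.addRight ⟨1, h1⟩) _ _ fun i => ?_
    rw [Equiv.coe_addRight, add_one_add_one h1 h2]
  have hterm : ∀ i : Fin N,
      ((SdotS N i (i + ⟨1, h1⟩) + (1/2 : ℂ) • SdotS N i (i + ⟨2, h2⟩)).mulVec v) s =
      (1/2) * v (s ∘ Equiv.swap i (i + ⟨1, h1⟩)) + (1/4) * v (s ∘ Equiv.swap i (i + ⟨2, h2⟩))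
        - (3/8) * v s := by
    intro i
    obtain ⟨h12, h13, -⟩ := consecutive_ne h1 h2 i
    rw [Matrix.add_mulVec, Matrix.smul_mulVec, Pi.add_apply, Pi.smul_apply, SdotS_mulVec h12,
      SdotS_mulVec h13, smul_eq_mul]
    ring
  rw [majumdarGhosh, Matrix.sum_mulVec, Finset.sum_apply]
  simp only [hterm, swapSum, Finset.sum_sub_distrib, Finset.sum_add_distrib, ← Finset.mul_sum,
    hshift, Finset.sum_const, Finset.card_univ, Fintype.card_fin, nsmul_eq_mul]
  ring

lemma majumdarGhosh_mulVec_dimerState {N n : ℕ} (h1 : 1 < N) (h2 : 2 < N) {f g : Fin n → Fin N}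
    (hf : f.Injective) (hg : g.Injective) (hfg : ∀ j k, f j ≠ g k)
    (hcover : ∀ i : Fin N, (∃ k, f k = i ∧ g k = i + ⟨1, h1⟩) ∨
      ∃ k, f k = i + ⟨1, h1⟩ ∧ g k = i + ⟨2, h2⟩) :
    (majumdarGhosh N h1 h2).mulVec (dimerState f g) =
      ((-(3 * (N : ℝ)) / 8 : ℝ) : ℂ) • dimerState f g := by
  ext s
  rw [majumdarGhosh_mulVec, Finset.sum_eq_zero, Pi.smul_apply, smul_eq_mul]
  · push_cast
    ring
  · intro i _
    obtain ⟨h12, h13, h23⟩ := consecutive_ne h1 h2 i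
    rcases hcover i with ⟨k, hfk, hgk⟩ | ⟨k, hfk, hgk⟩
    · refine swapSum_eq_zero h12 h13 h23 (fun t => ?_) s
      rw [← hgk, ← hfk]
      exact dimerState_comp_swap hf hg hfg k t
    · rw [← swapSum_rotate]
      refine swapSum_eq_zero h23 h12.symm h13.symm (fun t => ?_) s
      rw [← hgk, ← hfk]
      exact dimerState_comp_swap hf hg hfg k t

lemma le_of_majumdarGhosh_mulVec_eq {N : ℕ} (h1 : 1 < N) (h2 : 2 < N) {c : ℝ}
    {v : (Fin N → Fin 2) → ℂ} (hv : v ≠ 0)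
    (hc : (majumdarGhosh N h1 h2).mulVec v = (c : ℂ) • v) : -(3 * (N : ℝ)) / 8 ≤ c := by
  have hpos : 0 < ∑ s, Complex.normSq (v s) := by
    obtain ⟨s, hs⟩ := Function.ne_iff.mp hv
    exact Finset.sum_pos' (fun t _ => Complex.normSq_nonneg _)
      ⟨s, Finset.mem_univ s, Complex.normSq_pos.mpr hs⟩
  have key : ((c + 3 * N / 8 : ℝ) : ℂ) * ((∑ s, Complex.normSq (v s) : ℝ) : ℂ) =
      ((1/4 : ℝ) : ℂ) * ∑ i, ∑ s, star (v s) * swapSum i (i + ⟨1, h1⟩) (i + ⟨2, h2⟩) v s := by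
    rw [Finset.sum_comm, Complex.ofReal_sum, Finset.mul_sum, Finset.mul_sum]
    refine Finset.sum_congr rfl fun s _ => ?_
    have h := congrFun hc s
    rw [majumdarGhosh_mulVec, Pi.smul_apply, smul_eq_mul] at h
    rw [← Finset.mul_sum, Complex.normSq_eq_conj_mul_self, Complex.star_def]
    push_cast
    linear_combination (-(starRingEnd ℂ) (v s)) * h
  have hre := congrArg Complex.re key
  rw [Complex.re_ofReal_mul, Complex.re_ofReal_mul, Complex.ofReal_re, Complex.re_sum] at hre
  have hnn : 0 ≤ ∑ i, (∑ s, star (v s) * swapSum i (i + ⟨1, h1⟩) (i + ⟨2, h2⟩) v s).re :=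
    Finset.sum_nonneg fun i _ =>
      have ⟨h12, h13, h23⟩ := consecutive_ne h1 h2 i
      star_dotProduct_swapSum_nonneg h12 h13 h23 v
  have : 0 ≤ c + 3 * N / 8 := nonneg_of_mul_nonneg_left (by rw [hre]; positivity) hpos
  linarith

/-- For the Majumdar–Ghosh Hamiltonian
`H = Σ_i (S_i·S_{i+1} + ½ S_i·S_{i+2})` on `N = 2n` qubits with periodic boundary
conditions, the dimerized state `Ψ = ⊗_k |s⟩_{2k−1,2k}` is an eigenvector of `H` with
eigenvalue `−3N/8`, this eigenvalue is the smallest eigenvalue of `H`, and the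
translated dimer covering `⊗_k |s⟩_{2k,2k+1}` is likewise an eigenvector of `H` with
the same smallest eigenvalue. -/
theorem majumdar_ghosh_dimerized_ground_states
    (n : ℕ) (hn : 2 ≤ n)
    (H : Matrix (Fin (2*n) → Fin 2) (Fin (2*n) → Fin 2) ℂ)
    (hH : H = ∑ i : Fin (2*n),
      (SdotS (2*n) i (i + ⟨1, by omega⟩) + (1/2 : ℂ) • SdotS (2*n) i (i + ⟨2, by omega⟩)))
    (Ψ Ψ' : (Fin (2*n) → Fin 2) → ℂ)
    (hΨ : Ψ = fun s => ∏ k : Fin n,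
      sAmp (s ⟨2*k.val, by have := k.isLt; omega⟩) (s ⟨2*k.val+1, by have := k.isLt; omega⟩))
    (hΨ' : Ψ' = fun s => ∏ k : Fin n,
      sAmp (s ⟨2*k.val+1, by have := k.isLt; omega⟩)
        (s ((⟨2*k.val+1, by have := k.isLt; omega⟩ : Fin (2*n)) + ⟨1, by omega⟩))) :
    H.mulVec Ψ = ((-(3 * (2*n : ℝ)) / 8 : ℝ) : ℂ) • Ψ ∧
    IsLeast {c : ℝ | ∃ v : (Fin (2*n) → Fin 2) → ℂ, v ≠ 0 ∧ H.mulVec v = (c : ℂ) • v}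
      (-(3 * (2*n : ℝ)) / 8) ∧
    H.mulVec Ψ' = ((-(3 * (2*n : ℝ)) / 8 : ℝ) : ℂ) • Ψ' := by
  have h1 : 1 < 2 * n := by omega
  have h2 : 2 < 2 * n := by omega
  have hH' : H = majumdarGhosh (2 * n) h1 h2 := hH
  have hcast : ((2 * n : ℕ) : ℝ) = 2 * (n : ℝ) := by push_cast; ring
  have hfg : ∀ j k : Fin n, (⟨2 * j.val, by omega⟩ : Fin (2 * n)) ≠ ⟨2 * k.val + 1, by omega⟩ := by
    intro j k h
    rw [Fin.mk.injEq] at h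
    omega
  have hdimer := majumdarGhosh_mulVec_dimerState h1 h2
    (f := fun k : Fin n => ⟨2 * k.val, by omega⟩) (g := fun k => ⟨2 * k.val + 1, by omega⟩)
    (fun j k h => by rw [Fin.mk.injEq] at h; omega)
    (fun j k h => by rw [Fin.mk.injEq] at h; omega) hfg
    (fun i => by
      simp only [Fin.ext_iff, val_add_mk]
      rcases Nat.even_or_odd' i.val with ⟨m, hm | hm⟩
      · exact Or.inl ⟨⟨m, by omega⟩, by grind⟩
      · by_cases hlast : m + 1 < n
        · exact Or.inr ⟨⟨m + 1, hlast⟩, by grind⟩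
        · exact Or.inr ⟨⟨0, by omega⟩, by grind⟩)
  have hdimer' := majumdarGhosh_mulVec_dimerState h1 h2
    (f := fun k : Fin n => ⟨2 * k.val + 1, by omega⟩)
    (g := fun k => (⟨2 * k.val + 1, by omega⟩ : Fin (2 * n)) + ⟨1, h1⟩)
    (fun j k h => by rw [Fin.mk.injEq] at h; omega)
    (fun j k h => by
      simp only [Fin.ext_iff, val_add_mk] at h
      grind)
    (fun j k h => by
      simp only [Fin.ext_iff, val_add_mk] at h
      grind)
    (fun i => by
      simp only [Fin.ext_iff, val_add_mk]
      rcases Nat.even_or_odd' i.val with ⟨m, hm | hm⟩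
      · exact Or.inr ⟨⟨m, by omega⟩, by grind⟩
      · exact Or.inl ⟨⟨m, by omega⟩, by grind⟩)
  rw [hcast] at hdimer hdimer'
  subst hH' hΨ hΨ'
  refine ⟨hdimer, ⟨⟨_, dimerState_ne_zero hfg, hdimer⟩, ?_⟩, hdimer'⟩
  rintro c ⟨v, hv, hc⟩
  rw [← hcast]
  exact le_of_majumdarGhosh_mulVec_eq h1 h2 hv hc

end
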